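/- Let H be a complex Hilbert space, ι a countable index type, and ψ : ι → H a total Bessel sequence with bounded analysis operator C : H → ℓ²(ι), (C f)_k = ⟨ψ_k, f⟩. Let G := C ∘ C* : ℓ²(ι) → ℓ²(ι) be the Gram operator and √G its positive square root. Then √G restricted to the closure of Ran(C) is an injective map whose image is exactly Ran(C); that is, √G maps the closed subspace cl(Ran(C)) bijectively onto Ran(C). -/

import Mathlib

open scoped ComplexInnerProductSpace

open ContinuousLinearMap in
theorem aux_range_le {E F K : Type*} [NormedAddCommGroup E] [InnerProductSpace ℂ E] [CompleteSpace E]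
    [NormedAddCommGroup F] [InnerProductSpace ℂ F] [CompleteSpace F]
    [NormedAddCommGroup K] [InnerProductSpace ℂ K] [CompleteSpace K]
    (A : E →L[ℂ] K) (B : F →L[ℂ] K)
    (h : ∀ x, A (adjoint A x) = B (adjoint B x)) :
    (∀ x, ‖adjoint A x‖ = ‖adjoint B x‖) ∧ ∀ e, ∃ f, B f = A e := by
  have hn : ∀ x, ‖adjoint A x‖ = ‖adjoint B x‖ := by
    intro x
    have h1 : ⟪adjoint A x, adjoint A x⟫ = ⟪adjoint B x, adjoint B x⟫ := by
      rw [adjoint_inner_left, adjoint_inner_left, h]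
    rw [inner_self_eq_norm_sq_to_K, inner_self_eq_norm_sq_to_K] at h1
    have h2 : ‖adjoint A x‖ ^ 2 = ‖adjoint B x‖ ^ 2 := by exact_mod_cast h1
    exact (sq_eq_sq₀ (norm_nonneg _) (norm_nonneg _)).1 h2
  refine ⟨hn, fun e => ?_⟩
  set R := (adjoint A).range.topologicalClosure with hR
  haveI : CompleteSpace R := (Submodule.isClosed_topologicalClosure _).completeSpace_coe
  obtain ⟨p, hp, q, hq, rfl⟩ := R.exists_add_mem_mem_orthogonal e
  have hAq : A q = 0 := by
    rw [← inner_self_eq_zero (𝕜 := ℂ), ← adjoint_inner_left]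
    exact hq _ (Submodule.le_topologicalClosure _ ⟨A q, rfl⟩)
  have hp' : p ∈ closure (Set.range (adjoint A)) := hp
  obtain ⟨u, hu, hlim⟩ := mem_closure_iff_seq_limit.1 hp'
  choose x hx using hu
  obtain rfl : (fun n => adjoint A (x n)) = u := funext hx
  have hc : CauchySeq (fun n => adjoint B (x n)) := by
    have := hlim.cauchySeq
    rw [Metric.cauchySeq_iff] at this ⊢
    simpa only [dist_eq_norm, ← map_sub, hn] using this
  obtain ⟨g, hg⟩ := cauchySeq_tendsto_of_complete hc
  refine ⟨g, ?_⟩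
  have h1 := (B.continuous.tendsto g).comp hg
  have h2 := (A.continuous.tendsto p).comp hlim
  have h3 : (⇑B ∘ fun n => adjoint B (x n)) = (⇑A ∘ fun n => adjoint A (x n)) :=
    funext fun n => (h (x n)).symm
  rw [h3] at h1
  rw [map_add, hAq, add_zero]
  exact tendsto_nhds_unique h1 h2

/-- For a total Bessel sequence `ψ : ι → H` with analysis operator
`C : H → ℓ²(ι)` and Gram operator `G = C C*`, the positive square root `√G` (the unique
positive operator whose square is `G`) maps the closure of `Ran C` bijectively onto
`Ran C`. -/
theorem sqrt_gram_bijOn_closure_range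
    {H : Type*} [NormedAddCommGroup H] [InnerProductSpace ℂ H] [CompleteSpace H]
    {ι : Type*} [Countable ι] (ψ : ι → H) (M : ℝ)
    (hbessel : ∀ f : H, Summable (fun k => ‖⟪ψ k, f⟫‖ ^ 2) ∧
      ∑' k, ‖⟪ψ k, f⟫‖ ^ 2 ≤ M * ‖f‖ ^ 2)
    (htotal : (Submodule.span ℂ (Set.range ψ)).topologicalClosure = ⊤)
    (C : H →L[ℂ] lp (fun _ : ι => ℂ) 2)
    (hC : ∀ (f : H) (k : ι), C f k = ⟪ψ k, f⟫)
    (sqrtG : lp (fun _ : ι => ℂ) 2 →L[ℂ] lp (fun _ : ι => ℂ) 2)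
    (hpos : sqrtG.IsPositive)
    (hsq : sqrtG.comp sqrtG = C.comp (ContinuousLinearMap.adjoint C)) :
    Set.BijOn ⇑sqrtG (closure (Set.range ⇑C)) (Set.range ⇑C) := by
  have hadj : ContinuousLinearMap.adjoint sqrtG = sqrtG := hpos.isSelfAdjoint.adjoint_eq
  have hS : ∀ x, sqrtG (ContinuousLinearMap.adjoint sqrtG x) =
      C (ContinuousLinearMap.adjoint C x) := fun x => by
    rw [hadj]; exact DFunLike.congr_fun hsq x
  obtain ⟨hn, hSC⟩ := aux_range_le sqrtG C hS
  obtain ⟨-, hCS⟩ := aux_range_le C sqrtG (fun x => (hS x).symm)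
  rw [hadj] at hn
  set R := C.range.topologicalClosure with hR
  have hRs : closure (Set.range ⇑C) = (R : Set _) := rfl
  haveI : CompleteSpace R := (Submodule.isClosed_topologicalClosure _).completeSpace_coe
  have hker : ∀ x, sqrtG x = 0 ↔ x ∈ Rᗮ := by
    intro x
    rw [hR, Submodule.orthogonal_closure, ContinuousLinearMap.orthogonal_range, LinearMap.mem_ker,
      ← norm_eq_zero, hn, norm_eq_zero]
    rfl
  rw [hRs]
  refine ⟨fun x _ => hSC x, fun x hx y hy hxy => ?_, ?_⟩
  · have h1 : x - y ∈ Rᗮ := (hker _).1 (by rw [map_sub, hxy, sub_self])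
    have h2 : x - y ∈ R := R.sub_mem hx hy
    exact sub_eq_zero.1 ((inner_self_eq_zero (𝕜 := ℂ)).1 (h1 _ h2))
  · rintro _ ⟨e, rfl⟩
    obtain ⟨g, hg⟩ := hCS e
    obtain ⟨p, hp, q, hq, rfl⟩ := R.exists_add_mem_mem_orthogonal g
    refine ⟨p, hp, ?_⟩
    rw [← hg, map_add, (hker q).2 hq, add_zero]
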